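/- arXiv:2209.05088 — 3 statements merged into one kernel-verified Lean document; each statement's English description precedes it below -/
import Mathlib

section
/- The antilinear operators R := Γ_{n+1} ∘ ⋯ ∘ Γ_{2n} ∘ c and R' := Γ₁ ∘ ⋯ ∘ Γₙ ∘ c on Λℂⁿ satisfy R ∘ R = (−1)^{n(n−1)/2} · id and R' ∘ R' = (−1)^{n(n+1)/2} · id. -/
/-!
Polyform model: the antilinear operators `R = Γ_{n+1} ⋯ Γ_{2n} ∘ c` and
`R' = Γ₁ ⋯ Γₙ ∘ c` (anti)commute with all the Gamma operators.
-/

noncomputable section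

/-- The space of polyforms `Λℂⁿ`, the exterior algebra of `ℂⁿ`. -/
abbrev Polyform (n : ℕ) : Type := ExteriorAlgebra ℂ (Fin n → ℂ)

/-- The creation operator `aᵢ† : ω ↦ eᵢ ∧ ω`, wedging with the `i`-th standard basis vector. -/
def creation (n : ℕ) (i : Fin n) : Polyform n →ₗ[ℂ] Polyform n :=
  LinearMap.mulLeft ℂ (ExteriorAlgebra.ι ℂ (Pi.single i 1))

/-- The annihilation operator `aᵢ`, contraction (interior product) with the `i`-th
dual basis vector. -/
def annihilation (n : ℕ) (i : Fin n) : Polyform n →ₗ[ℂ] Polyform n :=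
  CliffordAlgebra.contractLeft (Q := (0 : QuadraticForm ℂ (Fin n → ℂ))) (LinearMap.proj i)

/-- The Gamma operators, indexed (0-based) by `A ∈ Fin (2n)`:
for `A = i` with `i < n`, `Γᵢ = i (aᵢ - aᵢ†)`; for `A = i + n`, `Γ_{i+n} = aᵢ + aᵢ†`. -/
def gammaOp (n : ℕ) (A : Fin (2 * n)) : Polyform n →ₗ[ℂ] Polyform n :=
  if h : (A : ℕ) < n then
    Complex.I • (annihilation n ⟨A, h⟩ - creation n ⟨A, h⟩)
  else
    annihilation n ⟨(A : ℕ) - n, by have := A.isLt; omega⟩ +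
      creation n ⟨(A : ℕ) - n, by have := A.isLt; omega⟩

/-- `IsConjugation n c` says that `c : Λℂⁿ → Λℂⁿ` is the canonical antilinear conjugation:
it is additive, conjugate-homogeneous, and fixes every basis polyform (equivalently, it fixes
the empty polyform `1` and commutes with wedging by any standard basis one-form `eᵢ`).
These properties determine `c` uniquely. -/
structure IsConjugation (n : ℕ) (c : Polyform n → Polyform n) : Prop where
  map_add : ∀ x y : Polyform n, c (x + y) = c x + c y
  map_smul : ∀ (a : ℂ) (x : Polyform n), c (a • x) = (starRingEnd ℂ) a • c x
  map_one : c 1 = 1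
  comm_wedge : ∀ (i : Fin n) (x : Polyform n),
    c (ExteriorAlgebra.ι ℂ (Pi.single i 1) * x) = ExteriorAlgebra.ι ℂ (Pi.single i 1) * c x

/-- The antilinear operator `R := Γ_{n+1} ∘ ⋯ ∘ Γ_{2n} ∘ c`. -/
def Rop (n : ℕ) (c : Polyform n → Polyform n) : Polyform n → Polyform n := fun x =>
  (((List.finRange n).map fun (i : Fin n) =>
    gammaOp n ⟨n + (i : ℕ), by have := i.isLt; omega⟩).prod : Module.End ℂ (Polyform n)) (c x)

/-- The antilinear operator `R' := Γ₁ ∘ ⋯ ∘ Γₙ ∘ c`. -/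
def Rop' (n : ℕ) (c : Polyform n → Polyform n) : Polyform n → Polyform n := fun x =>
  (((List.finRange n).map fun (i : Fin n) =>
    gammaOp n ⟨(i : ℕ), by have := i.isLt; omega⟩).prod : Module.End ℂ (Polyform n)) (c x)

/-- The square of a product of distinct, pairwise anticommuting involutions. -/
theorem List.prod_map_mul_self_of_anticomm {ι M : Type*} [Ring M] (G : ι → M)
    (sq : ∀ i, G i * G i = 1) (anti : ∀ i j, i ≠ j → G i * G j = -(G j * G i))
    (l : List ι) (hl : l.Nodup) :
    (l.map G).prod * (l.map G).prod = (-1) ^ l.length.choose 2 := by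
  have move : ∀ (i : ι) (l : List ι), i ∉ l →
      (l.map G).prod * G i = (-1) ^ l.length * (G i * (l.map G).prod) := by
    intro i l
    induction l with
    | nil => simp
    | cons j l ih =>
      intro h
      simp only [List.mem_cons, not_or] at h
      have comm : G j * (-1) ^ l.length = (-1) ^ l.length * G j :=
        ((Commute.neg_one_right (G j)).pow_right _).eq
      rw [List.map_cons, List.prod_cons, List.length_cons, mul_assoc, ih h.2, ← mul_assoc, comm,
        mul_assoc, ← mul_assoc (G j), anti j i (Ne.symm h.1), pow_succ]
      simp only [mul_assoc, neg_mul, mul_neg, one_mul]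
  induction l with
  | nil => simp
  | cons j l ih =>
    rw [List.nodup_cons] at hl
    have comm : G j * (-1) ^ l.length = (-1) ^ l.length * G j :=
      ((Commute.neg_one_right (G j)).pow_right _).eq
    rw [List.map_cons, List.prod_cons, List.length_cons, mul_assoc, ← mul_assoc _ (G j),
      move j l hl.1, mul_assoc, ← mul_assoc (G j), comm, mul_assoc, mul_assoc (G j),
      ← mul_assoc (G j), sq, one_mul, ih hl.2, Nat.choose_succ_succ' l.length 1,
      Nat.choose_one_right, pow_add]

/-- Anticommutator of the operators `aᵢ + s aᵢ†` on polyforms. -/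
theorem annihilation_add_smul_creation_anticomm (n : ℕ) (s : ℂ) (i j : Fin n) :
    (annihilation n i + s • creation n i : Module.End ℂ (Polyform n)) *
        (annihilation n j + s • creation n j) +
      (annihilation n j + s • creation n j) * (annihilation n i + s • creation n i) =
      (if i = j then 2 * s else 0) • 1 := by
  have caa : ∀ x, annihilation n i (annihilation n j x) = -annihilation n j (annihilation n i x) :=
    fun x => CliffordAlgebra.contractLeft_comm _ _ _
  have cac : ∀ (k l : Fin n) (x : Polyform n), annihilation n k (creation n l x) =
      (if k = l then (1 : ℂ) else 0) • x - creation n l (annihilation n k x) := by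
    intro k l x
    refine (CliffordAlgebra.contractLeft_ι_mul _ _ _).trans ?_
    simp only [LinearMap.proj_apply, Pi.single_apply]
    rfl
  have ccc : ∀ x, creation n i (creation n j x) = -creation n j (creation n i x) := by
    intro x
    simp only [creation, LinearMap.mulLeft_apply, ← mul_assoc]
    rw [eq_neg_of_add_eq_zero_left (ExteriorAlgebra.ι_add_mul_swap _ _), neg_mul]
  refine LinearMap.ext fun x => ?_
  simp only [LinearMap.add_apply, Module.End.mul_apply, LinearMap.smul_apply, map_add, map_smul,
    caa, cac, ccc, Module.End.one_apply]
  by_cases h : i = j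
  · subst h
    simp only [if_true]
    module
  · simp only [h, Ne.symm h, if_false]
    module

namespace IsConjugation

variable {n : ℕ} {c : Polyform n → Polyform n}

theorem map_neg (hc : IsConjugation n c) (x : Polyform n) : c (-x) = -c x := by
  simpa using hc.map_smul (-1) x

theorem map_sub (hc : IsConjugation n c) (x y : Polyform n) : c (x - y) = c x - c y := by
  rw [sub_eq_add_neg, hc.map_add, hc.map_neg, sub_eq_add_neg]

theorem map_ι_mul (hc : IsConjugation n c) (v : Fin n → ℂ) (x : Polyform n) :
    c (ExteriorAlgebra.ι ℂ v * x) = ExteriorAlgebra.ι ℂ (star v) * c x := by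
  let C : Polyform n →+ Polyform n := AddMonoidHom.mk' c hc.map_add
  have key : ∀ w : Fin n → ℂ, ExteriorAlgebra.ι ℂ w =
      ∑ i, w i • ExteriorAlgebra.ι ℂ (Pi.single i 1 : Fin n → ℂ) := by
    intro w
    conv_lhs => rw [pi_eq_sum_univ' w]
    simp only [map_sum, _root_.map_smul]
  rw [key v, key (star v), Finset.sum_mul, Finset.sum_mul]
  change C _ = _
  rw [map_sum]
  refine Finset.sum_congr rfl fun i _ => ?_
  change c _ = _
  rw [smul_mul_assoc, hc.map_smul, hc.comm_wedge, smul_mul_assoc]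
  rfl

theorem map_algebraMap (hc : IsConjugation n c) (r : ℂ) :
    c (algebraMap ℂ _ r) = algebraMap ℂ _ (starRingEnd ℂ r) := by
  rw [Algebra.algebraMap_eq_smul_one, hc.map_smul, hc.map_one, Algebra.algebraMap_eq_smul_one]

theorem apply_apply (hc : IsConjugation n c) (x : Polyform n) : c (c x) = x := by
  induction x using CliffordAlgebra.left_induction with
  | algebraMap r => erw [hc.map_algebraMap, hc.map_algebraMap]; simp
  | add x y hx hy => rw [hc.map_add, hc.map_add, hx, hy]
  | ι_mul x v hx => erw [hc.map_ι_mul, hc.map_ι_mul, hx, star_star]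

theorem map_annihilation (hc : IsConjugation n c) (i : Fin n) (x : Polyform n) :
    c (annihilation n i x) = annihilation n i (c x) := by
  have ann_ι_mul : ∀ (v : Fin n → ℂ) (y : Polyform n),
      annihilation n i (ExteriorAlgebra.ι ℂ v * y) =
        v i • y - ExteriorAlgebra.ι ℂ v * annihilation n i y :=
    fun v y => CliffordAlgebra.contractLeft_ι_mul _ _ _
  have ann_algebraMap : ∀ r : ℂ, annihilation n i (algebraMap ℂ _ r) = 0 :=
    fun r => CliffordAlgebra.contractLeft_algebraMap _ _ _
  have map_zero : c 0 = 0 := by simpa using hc.map_smul 0 0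
  induction x using CliffordAlgebra.left_induction with
  | algebraMap r =>
    erw [hc.map_algebraMap, ann_algebraMap, ann_algebraMap]
    exact map_zero
  | add x y hx hy => rw [_root_.map_add, hc.map_add, hc.map_add, _root_.map_add, hx, hy]
  | ι_mul x v hx =>
    erw [hc.map_ι_mul, ann_ι_mul, ann_ι_mul, hc.map_sub, hc.map_smul, hc.map_ι_mul, hx]
    rfl

theorem map_creation (hc : IsConjugation n c) (i : Fin n) (x : Polyform n) :
    c (creation n i x) = creation n i (c x) :=
  hc.comm_wedge i x

/-- Square of `G₁ ∘ ⋯ ∘ Gₙ ∘ c` for anticommuting involutions `Gᵢ` which commute with the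
conjugation `c` up to the sign `(-1) ^ k`. -/
theorem prod_comp_sq (hc : IsConjugation n c) (G : Fin n → Module.End ℂ (Polyform n)) (k : ℕ)
    (sq : ∀ i, G i * G i = 1) (anti : ∀ i j, i ≠ j → G i * G j = -(G j * G i))
    (hG : ∀ i x, c (G i x) = (-1 : ℂ) ^ k • G i (c x)) (x : Polyform n) :
    ((List.finRange n).map G).prod (c (((List.finRange n).map G).prod (c x))) =
      (-1 : ℂ) ^ (k * n + n.choose 2) • x := by
  have move : ∀ (l : List (Fin n)) (y : Polyform n),
      c ((l.map G).prod y) = (-1 : ℂ) ^ (k * l.length) • (l.map G).prod (c y) := by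
    intro l y
    induction l with
    | nil => simp
    | cons i l ih =>
      simp only [List.map_cons, List.prod_cons, Module.End.mul_apply, List.length_cons]
      rw [hG, ih, _root_.map_smul, smul_smul, ← pow_add]
      congr 2
      ring
  have h := List.prod_map_mul_self_of_anticomm G sq anti _ (List.nodup_finRange n)
  rw [List.length_finRange] at h
  have hpow : ((-1) ^ n.choose 2 : Module.End ℂ (Polyform n)) = (-1 : ℂ) ^ n.choose 2 • 1 := by
    have hs := smul_pow (-1 : ℂ) (1 : Module.End ℂ (Polyform n)) (n.choose 2)
    rwa [one_pow, neg_smul, one_smul] at hs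
  rw [move, hc.apply_apply, _root_.map_smul, ← Module.End.mul_apply, h, hpow, List.length_finRange,
    LinearMap.smul_apply, smul_smul, ← pow_add, Module.End.one_apply]

end IsConjugation

theorem gammaOp_of_lt (n : ℕ) (i : Fin n) (h : (i : ℕ) < 2 * n) :
    gammaOp n ⟨i, h⟩ = Complex.I • (annihilation n i + (-1 : ℂ) • creation n i) := by
  refine LinearMap.ext fun x => ?_
  simp [gammaOp, sub_eq_add_neg]

theorem gammaOp_add (n : ℕ) (i : Fin n) (h : n + (i : ℕ) < 2 * n) :
    gammaOp n ⟨n + i, h⟩ = annihilation n i + (1 : ℂ) • creation n i := by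
  simp [gammaOp]

/-- `R ∘ R = (-1)^(n(n-1)/2) id` and `R' ∘ R' = (-1)^(n(n+1)/2) id`. -/
theorem Rop_sq (n : ℕ) (hn : 1 ≤ n) (c : Polyform n → Polyform n)
    (hc : IsConjugation n c) :
    (∀ x : Polyform n, Rop n c (Rop n c x) = ((-1 : ℂ) ^ (n * (n - 1) / 2)) • x) ∧
    (∀ x : Polyform n, Rop' n c (Rop' n c x) = ((-1 : ℂ) ^ (n * (n + 1) / 2)) • x) := by
  have half {M : Module.End ℂ (Polyform n)} {s : ℂ} (h : M + M = (2 * s) • 1) : M = s • 1 := by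
    have h2 : (2 : ℂ) • M = (2 : ℂ) • (s • 1) := by rw [two_smul, h, smul_smul]
    exact smul_right_injective _ (two_ne_zero (α := ℂ)) h2
  constructor
  · intro x
    have h := hc.prod_comp_sq
      (fun i => gammaOp n ⟨n + (i : ℕ), by have := i.isLt; omega⟩) 0 ?_ ?_ ?_ x
    · rw [Nat.choose_two_right, zero_mul, zero_add] at h
      exact h
    · intro i
      have := annihilation_add_smul_creation_anticomm n 1 i i
      rw [if_pos rfl] at this
      simp only [gammaOp_add]
      rw [half this, one_smul]
    · intro i j hij
      have := annihilation_add_smul_creation_anticomm n 1 i j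
      rw [if_neg hij, zero_smul] at this
      simp only [gammaOp_add]
      exact eq_neg_of_add_eq_zero_left this
    · intro i y
      simp [gammaOp_add, hc.map_add, hc.map_annihilation, hc.map_creation]
  · intro x
    have h := hc.prod_comp_sq
      (fun i => gammaOp n ⟨(i : ℕ), by have := i.isLt; omega⟩) 1 ?_ ?_ ?_ x
    · have hexp : 1 * n + n.choose 2 = n * (n + 1) / 2 := by
        have h' := Nat.choose_succ_succ' n 1
        rw [Nat.choose_one_right, Nat.choose_two_right, Nat.add_sub_cancel] at h'
        rw [one_mul, ← h', mul_comm]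
      rw [hexp] at h
      exact h
    · intro i
      have := annihilation_add_smul_creation_anticomm n (-1) i i
      rw [if_pos rfl] at this
      simp only [gammaOp_of_lt]
      rw [smul_mul_smul_comm, half this, smul_smul, Complex.I_mul_I]
      simp
    · intro i j hij
      have := annihilation_add_smul_creation_anticomm n (-1) i j
      rw [if_neg hij, zero_smul] at this
      simp only [gammaOp_of_lt]
      rw [smul_mul_smul_comm, smul_mul_smul_comm, eq_neg_of_add_eq_zero_left this, smul_neg]
    · intro i y
      simp [gammaOp_of_lt, hc.map_add, hc.map_neg, hc.map_smul, hc.map_annihilation,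
        hc.map_creation]

end
end

section
/- For antisymmetric real 2n×2n matrices X, define the operator A(X) := (1/2) Σ_{A<B} X^{AB} Γ_A ∘ Γ_B on Λℂⁿ. Then the assignment X ↦ A(X) is a Lie algebra homomorphism: for all antisymmetric real 2n×2n matrices X and Y, the commutator satisfies A(X) ∘ A(Y) − A(Y) ∘ A(X) = A(XY − YX), where XY − YX is the matrix commutator. -/
/-!
Polyform model: the operators `Γ_{i+n} := aᵢ + aᵢ†` and `Γᵢ := i (aᵢ - aᵢ†)` on `Λℂⁿ`
satisfy the Clifford algebra relations.
-/

noncomputable section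

open Finset in
/-- The spin Lie algebra operator `A(X) := (1/2) ∑_{A<B} X^{AB} Γ_A Γ_B` on polyforms,
for a real antisymmetric `2n × 2n` matrix `X`. -/
def spinOp (n : ℕ) (X : Matrix (Fin (2 * n)) (Fin (2 * n)) ℝ) :
    Polyform n →ₗ[ℂ] Polyform n :=
  (1 / 2 : ℂ) • ∑ A : Fin (2 * n), ∑ B : Fin (2 * n),
    if A < B then ((X A B : ℂ) • (gammaOp n A ∘ₗ gammaOp n B)) else 0

/-- The quadratic element `∑ X A B • G A * G B` of an algebra attached to a matrix. -/
def bilinearElem {R ι : Type*} [Ring R] [Algebra ℂ R] [Fintype ι] (G : ι → R)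
    (X : Matrix ι ι ℝ) : R :=
  ∑ A, ∑ B, (X A B : ℂ) • (G A * G B)

section Clifford

variable {R ι : Type*} [Ring R] [Algebra ℂ R] [Fintype ι] {G : ι → R}

theorem bilinearElem_commutator_generator [DecidableEq ι]
    (hG : ∀ A B, G A * G B + G B * G A = if A = B then 2 else 0)
    {X : Matrix ι ι ℝ} (hX : X.transpose = -X) (C : ι) :
    bilinearElem G X * G C - G C * bilinearElem G X = (4 : ℂ) • ∑ A, (X A C : ℂ) • G A := by
  have hX' : ∀ A B, X B A = -X A B := fun A B => congrFun (congrFun hX A) B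
  have key : ∀ A B, G A * G B * G C - G C * (G A * G B) =
      (if B = C then (2 : ℂ) else 0) • G A - (if A = C then (2 : ℂ) else 0) • G B := by
    intro A B
    have h : G A * G B * G C - G C * (G A * G B) =
        G A * (G B * G C + G C * G B) - (G A * G C + G C * G A) * G B := by noncomm_ring
    rw [h, hG, hG]
    split_ifs <;> simp [two_smul, mul_two, two_mul]
  calc bilinearElem G X * G C - G C * bilinearElem G X
      = ∑ A, ∑ B, (X A B : ℂ) • (G A * G B * G C - G C * (G A * G B)) := by
        simp only [bilinearElem, Finset.sum_mul, Finset.mul_sum, ← Finset.sum_sub_distrib,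
          smul_mul_assoc, mul_smul_comm, smul_sub]
    _ = ∑ A, (2 : ℂ) • (X A C : ℂ) • G A - ∑ B, (2 : ℂ) • (X C B : ℂ) • G B := by
        simp only [key, smul_sub, Finset.sum_sub_distrib]
        congr 1
        · simp [smul_comm (2 : ℂ), ite_smul, smul_ite]
        · rw [Finset.sum_comm]
          simp [smul_comm (2 : ℂ), ite_smul, smul_ite]
    _ = _ := by
        rw [← Finset.sum_sub_distrib, Finset.smul_sum]
        refine Finset.sum_congr rfl fun A _ => ?_
        rw [hX' A C]
        push_cast
        module

theorem bilinearElem_commutator [DecidableEq ι]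
    (hG : ∀ A B, G A * G B + G B * G A = if A = B then 2 else 0)
    {X : Matrix ι ι ℝ} (hX : X.transpose = -X) (Y : Matrix ι ι ℝ) :
    bilinearElem G X * bilinearElem G Y - bilinearElem G Y * bilinearElem G X =
      (4 : ℂ) • bilinearElem G (X * Y - Y * X) := by
  have hX' : ∀ A B, X B A = -X A B := fun A B => congrFun (congrFun hX A) B
  have hcomm := bilinearElem_commutator_generator hG hX
  set T := bilinearElem G X
  calc T * bilinearElem G Y - bilinearElem G Y * T
      = ∑ C, ∑ D, (Y C D : ℂ) •
          ((T * G C - G C * T) * G D + G C * (T * G D - G D * T)) := by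
        simp only [bilinearElem, Finset.sum_mul, Finset.mul_sum, ← Finset.sum_sub_distrib,
          smul_mul_assoc, mul_smul_comm, ← smul_sub]
        refine Finset.sum_congr rfl fun C _ => Finset.sum_congr rfl fun D _ => ?_
        congr 1
        noncomm_ring
    _ = (4 : ℂ) • (∑ C, ∑ D, ∑ A, ((X A C * Y C D : ℝ) : ℂ) • (G A * G D) -
          ∑ C, ∑ D, ∑ A, ((Y C D * X D A : ℝ) : ℂ) • (G C * G A)) := by
        simp only [hcomm, ← Finset.sum_sub_distrib, Finset.smul_sum, Finset.sum_mul,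
          Finset.mul_sum, ← Finset.sum_add_distrib]
        refine Finset.sum_congr rfl fun C _ => Finset.sum_congr rfl fun D _ =>
          Finset.sum_congr rfl fun A _ => ?_
        rw [hX' A D]
        simp only [smul_mul_assoc, mul_smul_comm]
        push_cast
        module
    _ = _ := by
        simp only [bilinearElem, Matrix.sub_apply, Matrix.mul_apply, Complex.ofReal_sub,
          Complex.ofReal_sum, sub_smul, Finset.sum_sub_distrib, Finset.sum_smul]
        congr 2
        · rw [Finset.sum_congr rfl fun C _ => Finset.sum_comm, Finset.sum_comm]
          exact Finset.sum_congr rfl fun A _ => Finset.sum_comm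
        · exact Finset.sum_congr rfl fun C _ => Finset.sum_comm

theorem quarter_bilinearElem_commutator [DecidableEq ι]
    (hG : ∀ A B, G A * G B + G B * G A = if A = B then 2 else 0)
    {X : Matrix ι ι ℝ} (hX : X.transpose = -X) (Y : Matrix ι ι ℝ) :
    ((1 / 4 : ℂ) • bilinearElem G X) * ((1 / 4 : ℂ) • bilinearElem G Y) -
        ((1 / 4 : ℂ) • bilinearElem G Y) * ((1 / 4 : ℂ) • bilinearElem G X) =
      (1 / 4 : ℂ) • bilinearElem G (X * Y - Y * X) := by
  simp only [smul_mul_assoc, mul_smul_comm, ← smul_sub, bilinearElem_commutator hG hX Y]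
  module

theorem sum_lt_eq_bilinearElem [LinearOrder ι]
    (hG : ∀ A B, A ≠ B → G A * G B + G B * G A = 0)
    {X : Matrix ι ι ℝ} (hX : X.transpose = -X) :
    ∑ A, ∑ B, (if A < B then (X A B : ℂ) • (G A * G B) else 0) =
      (1 / 2 : ℂ) • bilinearElem G X := by
  have hX' : ∀ A B, X B A = -X A B := fun A B => congrFun (congrFun hX A) B
  have hsplit : ∀ A B, (X A B : ℂ) • (G A * G B) =
      (if A < B then (X A B : ℂ) • (G A * G B) else 0) +
        (if B < A then (X B A : ℂ) • (G B * G A) else 0) := by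
    intro A B
    rcases lt_trichotomy A B with h | rfl | h
    · simp [h, h.not_gt]
    · have : X A A = 0 := by linarith [hX' A A]
      simp [this]
    · rw [if_neg h.not_gt, if_pos h, hX' A B, eq_neg_of_add_eq_zero_left (hG A B h.ne')]
      simp
  have hswap : ∑ A, ∑ B, (if B < A then (X B A : ℂ) • (G B * G A) else 0) =
      ∑ A, ∑ B, (if A < B then (X A B : ℂ) • (G A * G B) else 0) := Finset.sum_comm
  have hsum : bilinearElem G X =
      (2 : ℂ) • ∑ A, ∑ B, (if A < B then (X A B : ℂ) • (G A * G B) else 0) := by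
    rw [bilinearElem, Finset.sum_congr rfl fun A _ => Finset.sum_congr rfl fun B _ => hsplit A B]
    simp only [Finset.sum_add_distrib]
    rw [hswap, two_smul]
  rw [hsum, smul_smul]
  norm_num

end Clifford

theorem creation_anticomm (n : ℕ) (i j : Fin n) :
    creation n i * creation n j + creation n j * creation n i = 0 := by
  refine LinearMap.ext fun x => ?_
  simp only [creation, LinearMap.add_apply, Module.End.mul_apply, LinearMap.mulLeft_apply,
    LinearMap.zero_apply, ← mul_assoc, ← add_mul]
  rw [ExteriorAlgebra.ι_add_mul_swap, zero_mul]

theorem annihilation_anticomm (n : ℕ) (i j : Fin n) :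
    annihilation n i * annihilation n j + annihilation n j * annihilation n i = 0 := by
  refine LinearMap.ext fun x => ?_
  simp only [annihilation, LinearMap.add_apply, Module.End.mul_apply, LinearMap.zero_apply]
  rw [CliffordAlgebra.contractLeft_comm, neg_add_cancel]

theorem annihilation_creation_anticomm (n : ℕ) (i j : Fin n) :
    annihilation n i * creation n j + creation n j * annihilation n i =
      if i = j then 1 else 0 := by
  refine LinearMap.ext fun x => ?_
  have h := CliffordAlgebra.contractLeft_ι_mul
    (Q := (0 : QuadraticForm ℂ (Fin n → ℂ))) (d := LinearMap.proj i) (Pi.single j 1) x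
  simp only [annihilation, creation, LinearMap.add_apply, Module.End.mul_apply,
    LinearMap.mulLeft_apply]
  erw [h]
  rw [sub_add_cancel]
  by_cases hij : i = j
  · subst hij; simp
  · simp [hij]

theorem gammaOp_anticomm (n : ℕ) (A B : Fin (2 * n)) :
    gammaOp n A * gammaOp n B + gammaOp n B * gammaOp n A = if A = B then 2 else 0 := by
  have anticomm : ∀ (s t u v : ℂ) (i j : Fin n),
      (s • annihilation n i + t • creation n i) * (u • annihilation n j + v • creation n j) +
        (u • annihilation n j + v • creation n j) * (s • annihilation n i + t • creation n i) =
      if i = j then (s * v + t * u) • 1 else 0 := by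
    intro s t u v i j
    have h : (s • annihilation n i + t • creation n i) *
          (u • annihilation n j + v • creation n j) +
        (u • annihilation n j + v • creation n j) * (s • annihilation n i + t • creation n i) =
        (s * u) • (annihilation n i * annihilation n j + annihilation n j * annihilation n i) +
        (s * v) • (annihilation n i * creation n j + creation n j * annihilation n i) +
        (t * u) • (annihilation n j * creation n i + creation n i * annihilation n j) +
        (t * v) • (creation n i * creation n j + creation n j * creation n i) := by
      simp only [mul_add, add_mul, smul_mul_assoc, mul_smul_comm]
      module
    rw [h, annihilation_anticomm, creation_anticomm, annihilation_creation_anticomm,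
      annihilation_creation_anticomm]
    by_cases hij : i = j
    · subst hij; simp [add_smul]
    · simp [hij, Ne.symm hij]
  have hlow : ∀ (C : Fin (2 * n)) (h : (C : ℕ) < n), gammaOp n C =
      Complex.I • annihilation n ⟨C, h⟩ + (-Complex.I) • creation n ⟨C, h⟩ := by
    intro C h
    rw [gammaOp, dif_pos h]
    module
  have hhigh : ∀ (C : Fin (2 * n)) (h : ¬ (C : ℕ) < n), gammaOp n C =
      (1 : ℂ) • annihilation n ⟨C - n, by omega⟩ + (1 : ℂ) • creation n ⟨C - n, by omega⟩ := by
    intro C h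
    rw [gammaOp, dif_neg h, one_smul, one_smul]
  have two : (2 : Module.End ℂ (Polyform n)) = (2 : ℂ) • 1 := by
    rw [two_smul, one_add_one_eq_two]
  by_cases hA : (A : ℕ) < n <;> by_cases hB : (B : ℕ) < n
  · rw [hlow A hA, hlow B hB, anticomm]
    simp [Fin.ext_iff, two, ← two_mul]
  · rw [hlow A hA, hhigh B hB, anticomm]
    have : A ≠ B := by rintro rfl; exact hB hA
    simp [this]
  · rw [hhigh A hA, hlow B hB, anticomm]
    have : A ≠ B := by rintro rfl; exact hA hB
    simp [this]
  · rw [hhigh A hA, hhigh B hB, anticomm]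
    have : (A : ℕ) - n = B - n ↔ (A : ℕ) = B := by omega
    simp [Fin.ext_iff, this, two, one_add_one_eq_two]

theorem spinOp_eq_bilinearElem (n : ℕ) {X : Matrix (Fin (2 * n)) (Fin (2 * n)) ℝ}
    (hX : X.transpose = -X) :
    spinOp n X = (1 / 4 : ℂ) • bilinearElem (R := Module.End ℂ (Polyform n)) (gammaOp n) X := by
  have h := sum_lt_eq_bilinearElem (R := Module.End ℂ (Polyform n)) (G := gammaOp n)
    (fun A B hAB => by rw [gammaOp_anticomm, if_neg hAB]) hX
  calc spinOp n X = (1 / 2 : ℂ) • (1 / 2 : ℂ) •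
        bilinearElem (R := Module.End ℂ (Polyform n)) (gammaOp n) X := congrArg _ h
    _ = _ := by rw [smul_smul]; norm_num

/-- `X ↦ A(X)` is a Lie algebra homomorphism:
`A(X) ∘ A(Y) − A(Y) ∘ A(X) = A(XY − YX)` for antisymmetric `X`, `Y`. -/
theorem spinOp_lie_hom (n : ℕ) (hn : 1 ≤ n)
    (X Y : Matrix (Fin (2 * n)) (Fin (2 * n)) ℝ)
    (hX : X.transpose = -X) (hY : Y.transpose = -Y) :
    spinOp n X ∘ₗ spinOp n Y - spinOp n Y ∘ₗ spinOp n X = spinOp n (X * Y - Y * X) := by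
  have hXY : (X * Y - Y * X).transpose = -(X * Y - Y * X) := by
    simp [Matrix.transpose_mul, hX, hY]
  rw [spinOp_eq_bilinearElem n hX, spinOp_eq_bilinearElem n hY, spinOp_eq_bilinearElem n hXY]
  exact quarter_bilinearElem_commutator (R := Module.End ℂ (Polyform n))
    (gammaOp_anticomm n) hX Y

end
end

section
/- Every vector v ∈ ℂ⁸ can be written as a sum of two isotropic vectors which are complex conjugates of each other up to a complex scalar: there exist u ∈ ℂ⁸ and λ ∈ ℂ such that B(u, u) = 0 and v = u + λ·conj(u), where B(z, w) := Σ_{i} z_i w_i is the standard ℂ-bilinear symmetric form and conj is componentwise complex conjugation. (In spinor language: every spinor of Cl(8), pure or impure, is a linear combination of two complex-conjugate pure spinors.) -/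
/-!
Every vector of `ℂ⁸` is the sum of two isotropic (null) vectors that are complex
conjugates of each other up to a complex scalar; in spinor language, every spinor of
`Cl(8)` is a linear combination of two complex-conjugate pure spinors.
-/

noncomputable section

/-- The standard ℂ-bilinear symmetric form `B(z, w) := ∑ᵢ zᵢ wᵢ` on `ℂ⁸`
(no complex conjugation). -/
def bilinC8 (z w : Fin 8 → ℂ) : ℂ := ∑ i, z i * w i

/-- Componentwise complex conjugation on `ℂ⁸`. -/
def conjC8 (z : Fin 8 → ℂ) : Fin 8 → ℂ := fun i => starRingEnd ℂ (z i)

lemma bilinC8_smul_smul (c : ℂ) (z : Fin 8 → ℂ) :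
    bilinC8 (c • z) (c • z) = c ^ 2 * bilinC8 z z := by
  simp only [bilinC8, Pi.smul_apply, smul_eq_mul, Finset.mul_sum]
  exact Finset.sum_congr rfl fun i _ => by ring

lemma bilinC8_add_I_mul (a b : Fin 8 → ℝ) :
    bilinC8 (fun i => a i + b i * Complex.I) (fun i => a i + b i * Complex.I) =
      ((a ⬝ᵥ a - b ⬝ᵥ b : ℝ) : ℂ) + ((2 * (a ⬝ᵥ b) : ℝ) : ℂ) * Complex.I := by
  simp only [bilinC8, dotProduct]
  push_cast
  rw [Finset.mul_sum, Finset.sum_mul, ← Finset.sum_sub_distrib, ← Finset.sum_add_distrib]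
  refine Finset.sum_congr rfl fun i _ => ?_
  linear_combination (b i : ℂ) ^ 2 * Complex.I_sq

/-- Every vector of `ℝ⁸` has an orthogonal vector of the same length. -/
lemma exists_orthogonal_dotProduct_self_eq (a : Fin 8 → ℝ) :
    ∃ b : Fin 8 → ℝ, a ⬝ᵥ b = 0 ∧ b ⬝ᵥ b = a ⬝ᵥ a := by
  refine ⟨![-a 1, a 0, -a 3, a 2, -a 5, a 4, -a 7, a 6], ?_, ?_⟩ <;>
  · simp [dotProduct, Fin.sum_univ_eight]
    ring

/-- The decomposition for orthogonal real and imaginary parts, the real one being the longer. -/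
lemma exists_isotropic_conj_decomposition_of_orthogonal (a b : Fin 8 → ℝ)
    (hab : a ⬝ᵥ b = 0) (hle : b ⬝ᵥ b ≤ a ⬝ᵥ a) :
    ∃ (u : Fin 8 → ℂ) (lam : ℂ), bilinC8 u u = 0 ∧
      (fun i => a i + b i * Complex.I) = u + lam • conjC8 u := by
  by_cases hb : b = 0
  · obtain ⟨y, hay, hyy⟩ := exists_orthogonal_dotProduct_self_eq a
    refine ⟨(1 / 2 : ℂ) • fun i => a i + y i * Complex.I, 1, ?_, ?_⟩
    · rw [bilinC8_smul_smul, bilinC8_add_I_mul, hay, hyy]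
      simp
    · ext i
      simp [conjC8, hb, Complex.conj_ofNat]
      ring
  · have hb0 : 0 < b ⬝ᵥ b :=
      lt_of_le_of_ne (Finset.sum_nonneg fun i _ => mul_self_nonneg (b i))
        (Ne.symm (mt dotProduct_self_eq_zero.mp hb))
    have hA : 0 < √(a ⬝ᵥ a) := Real.sqrt_pos.mpr (hb0.trans_le hle)
    have hB : 0 < √(b ⬝ᵥ b) := Real.sqrt_pos.mpr hb0
    have hA2 := Real.sq_sqrt (hb0.trans_le hle).le
    have hB2 := Real.sq_sqrt hb0.le
    set A := √(a ⬝ᵥ a)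
    set B := √(b ⬝ᵥ b)
    have hAc : (A : ℂ) ≠ 0 := by exact_mod_cast hA.ne'
    have hBc : (B : ℂ) ≠ 0 := by exact_mod_cast hB.ne'
    have hABc : (A : ℂ) + B ≠ 0 := by exact_mod_cast (add_pos hA hB).ne'
    refine ⟨((A + B) / 2 : ℂ) • fun i => ((A⁻¹ • a) i : ℝ) + ((B⁻¹ • b) i : ℝ) * Complex.I,
      (A - B) / (A + B), ?_, ?_⟩
    · rw [bilinC8_smul_smul, bilinC8_add_I_mul]
      simp only [smul_dotProduct, dotProduct_smul, hab, ← hA2, ← hB2, smul_eq_mul]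
      field_simp
      simp
    · ext i
      simp [conjC8, Complex.conj_ofNat]
      field_simp
      ring

lemma exists_unit_sq_mul_norm (q : ℂ) :
    ∃ c : ℂ, c * starRingEnd ℂ c = 1 ∧ q = c ^ 2 * (‖q‖ : ℂ) := by
  refine ⟨Complex.exp ((q.arg / 2 : ℝ) * Complex.I), ?_, ?_⟩
  · rw [Complex.mul_conj', Complex.norm_exp_ofReal_mul_I]
    simp
  · rw [← Complex.exp_nat_mul]
    conv_lhs => rw [← Complex.norm_mul_exp_arg_mul_I q, mul_comm]
    congr 2
    push_cast
    ring

/-- every `v ∈ ℂ⁸` can be written `v = u + λ · conj u` with `u` isotropic. -/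
theorem exists_isotropic_conj_decomposition (v : Fin 8 → ℂ) :
    ∃ (u : Fin 8 → ℂ) (lam : ℂ), bilinC8 u u = 0 ∧ v = u + lam • conjC8 u := by
  obtain ⟨c, hc, hq⟩ := exists_unit_sq_mul_norm (bilinC8 v v)
  set w : Fin 8 → ℂ := starRingEnd ℂ c • v with hw
  have hvw : v = c • w := by rw [hw, smul_smul, hc, one_smul]
  have hww : bilinC8 w w = (‖bilinC8 v v‖ : ℂ) := by
    rw [hw, bilinC8_smul_smul]
    linear_combination starRingEnd ℂ c ^ 2 * hq +
      (‖bilinC8 v v‖ : ℂ) * (c * starRingEnd ℂ c + 1) * hc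
  have hre : w = fun i => ((w i).re : ℂ) + ((w i).im : ℂ) * Complex.I :=
    funext fun i => (Complex.re_add_im (w i)).symm
  have hsum := bilinC8_add_I_mul (fun i => (w i).re) (fun i => (w i).im)
  rw [← hre, hww] at hsum
  have h_re := congrArg Complex.re hsum
  have h_im := congrArg Complex.im hsum
  simp only [Complex.add_re, Complex.add_im, Complex.ofReal_re, Complex.ofReal_im,
    Complex.re_ofReal_mul, Complex.im_ofReal_mul, Complex.I_re, Complex.I_im] at h_re h_im
  obtain ⟨u, t, hu, hwu⟩ := exists_isotropic_conj_decomposition_of_orthogonal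
    (fun i => (w i).re) (fun i => (w i).im) (by linarith)
    (by linarith [norm_nonneg (bilinC8 v v)])
  rw [← hre] at hwu
  refine ⟨c • u, c ^ 2 * t, by rw [bilinC8_smul_smul, hu, mul_zero], ?_⟩
  rw [hvw, hwu]
  ext i
  simp only [conjC8, Pi.smul_apply, Pi.add_apply, smul_eq_mul, map_mul]
  linear_combination -(c * t * starRingEnd ℂ (u i)) * hc

end
end
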